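/- Let p be an odd prime and let G be the semidirect product (ℤ/p²ℤ) ⋊ (ℤ/pℤ), where the generator 1 of ℤ/pℤ acts on ℤ/p²ℤ by multiplication by p+1 (this action is well defined since (p+1)^p ≡ 1 mod p²). Then G is a group of nilpotence class two which is not q-split: the quotient map G → G_ab admits no quadratic section. (Its abelianization is isomorphic to (ℤ/pℤ)² and its commutator subgroup to ℤ/pℤ, so G is similar to, but not isomorphic in Niq to, the q-split group ℤ/pℤ ∨ ℤ/pℤ.) -/

import Mathlib

/-- The cross-effect of a map between groups: `(a|b)_f = (f a * f b)⁻¹ * f (a*b)`. -/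
def crossEff {G H : Type*} [Group G] [Group H] (f : G → H) (a b : G) : H :=
  (f a * f b)⁻¹ * f (a * b)

/-- The commutator `[a,b] = a⁻¹ * b⁻¹ * a * b`. -/
def cmt {G : Type*} [Group G] (a b : G) : G := a⁻¹ * b⁻¹ * a * b

/-- A map between groups is weakly quadratic if its cross-effect commutes with all values
of `f` and is multiplicative in each variable. -/
def IsWeaklyQuadratic {G H : Type*} [Group G] [Group H] (f : G → H) : Prop :=
  (∀ a b c : G, Commute (crossEff f a b) (f c)) ∧
  (∀ a a' b : G, crossEff f (a * a') b = crossEff f a b * crossEff f a' b) ∧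
  (∀ a b b' : G, crossEff f a (b * b') = crossEff f a b * crossEff f a b')

/-- A quadratic map: weakly quadratic with central cross-effect values. -/
def IsQuadratic {G H : Type*} [Group G] [Group H] (f : G → H) : Prop :=
  IsWeaklyQuadratic f ∧ ∀ a b : G, crossEff f a b ∈ Subgroup.center H

/-- A q-map: weakly quadratic with cross-effect values in the commutator subgroup. -/
def IsQMap {G H : Type*} [Group G] [Group H] (f : G → H) : Prop :=
  IsWeaklyQuadratic f ∧ ∀ a b : G, crossEff f a b ∈ commutator H

/-- A nil₂-group is q-split if the projection onto its abelianization admits a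
quadratic section. -/
def QSplit (G : Type*) [Group G] : Prop :=
  ∃ s : Abelianization G → G, IsQuadratic s ∧ ∀ x : Abelianization G, Abelianization.of (s x) = x

theorem crossEff_spec {G H : Type*} [Group G] [Group H] (f : G → H) (a b : G) :
    f (a * b) = f a * f b * crossEff f a b := by
  rw [crossEff, mul_inv_cancel_left]

namespace IsWeaklyQuadratic

variable {G H : Type*} [Group G] [Group H] {f : G → H}

theorem crossEff_one_left (hf : IsWeaklyQuadratic f) (b : G) : crossEff f 1 b = 1 := by
  have h := hf.2.1 1 1 b
  rwa [mul_one, eq_comm, mul_eq_left] at h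

theorem crossEff_pow_left (hf : IsWeaklyQuadratic f) (a b : G) (n : ℕ) :
    crossEff f (a ^ n) b = crossEff f a b ^ n := by
  induction n with
  | zero => simpa using hf.crossEff_one_left b
  | succ n ih => rw [pow_succ, hf.2.1, ih, pow_succ]

theorem map_one (hf : IsWeaklyQuadratic f) : f 1 = 1 := by
  have h := crossEff_spec f 1 1
  rw [hf.crossEff_one_left, mul_one, mul_one, eq_comm, mul_eq_left] at h
  exact h

theorem map_pow (hf : IsWeaklyQuadratic f) (a : G) (n : ℕ) :
    f (a ^ n) = f a ^ n * crossEff f a a ^ n.choose 2 := by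
  induction n with
  | zero => simpa using hf.map_one
  | succ n ih =>
    have hc : Commute (crossEff f a a ^ n.choose 2) (f a) := (hf.1 a a a).pow_left _
    rw [pow_succ, crossEff_spec f, hf.crossEff_pow_left, ih, hc.right_comm, ← pow_succ,
      mul_assoc, ← pow_add, Nat.choose_succ_succ', Nat.choose_one_right, add_comm n (n.choose _)]

theorem pow_eq_one_of_odd (hf : IsWeaklyQuadratic f) {a : G} {n : ℕ} (hn : Odd n)
    (ha : a ^ n = 1) : f a ^ n = 1 := by
  have hc : crossEff f a a ^ n = 1 := by
    rw [← hf.crossEff_pow_left, ha, hf.crossEff_one_left]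
  obtain ⟨m, hm⟩ := hn
  have hchoose : n.choose 2 = n * m := by
    rw [Nat.choose_two_right, hm, Nat.add_sub_cancel, mul_left_comm,
      Nat.mul_div_cancel_left _ two_pos]
  have h := hf.map_pow a n
  rwa [ha, hf.map_one, hchoose, pow_mul, hc, one_pow, mul_one, eq_comm] at h

end IsWeaklyQuadratic

namespace ZMod

/-- Reduction modulo `p` on `ℤ/p²ℤ`. -/
def reduceSq (p : ℕ) : ZMod (p ^ 2) →+* ZMod p :=
  ZMod.castHom (dvd_pow_self p two_ne_zero) (ZMod p)

theorem natCast_self_mul_self (p : ℕ) : (p : ZMod (p ^ 2)) * p = 0 := by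
  rw [← Nat.cast_mul, ← sq, ZMod.natCast_self]

/-- The embedding `ℤ/pℤ → ℤ/p²ℤ` induced by multiplication by `p`. -/
def mulSelfSq (p : ℕ) : ZMod p →+ ZMod (p ^ 2) :=
  ZMod.lift p ⟨(AddMonoidHom.mulLeft (p : ZMod (p ^ 2))).comp (Int.castAddHom _), by
    simpa using natCast_self_mul_self p⟩

theorem mulSelfSq_intCast (p : ℕ) (z : ℤ) : mulSelfSq p z = p * z := by
  simp [mulSelfSq]

theorem mulSelfSq_reduceSq (p : ℕ) (x : ZMod (p ^ 2)) : mulSelfSq p (reduceSq p x) = p * x := by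
  obtain ⟨z, rfl⟩ := ZMod.intCast_surjective x
  rw [map_intCast, mulSelfSq_intCast]

theorem reduceSq_surjective (p : ℕ) : Function.Surjective (reduceSq p) := fun k => by
  obtain ⟨z, rfl⟩ := ZMod.intCast_surjective k
  exact ⟨z, map_intCast _ z⟩

theorem reduceSq_mulSelfSq (p : ℕ) (k : ZMod p) : reduceSq p (mulSelfSq p k) = 0 := by
  obtain ⟨z, rfl⟩ := ZMod.intCast_surjective k
  simp [mulSelfSq_intCast]

theorem exists_mulSelfSq_eq (p : ℕ) {x : ZMod (p ^ 2)} (hx : reduceSq p x = 0) :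
    ∃ k, mulSelfSq p k = x := by
  obtain ⟨z, rfl⟩ := ZMod.intCast_surjective x
  rw [map_intCast, ZMod.intCast_zmod_eq_zero_iff_dvd] at hx
  obtain ⟨w, rfl⟩ := hx
  exact ⟨w, by simp [mulSelfSq_intCast]⟩

theorem mulSelfSq_injective {p : ℕ} (hp : p ≠ 0) : Function.Injective (mulSelfSq p) := by
  refine (injective_iff_map_eq_zero _).2 fun k hk => ?_
  obtain ⟨z, rfl⟩ := ZMod.intCast_surjective k
  rw [mulSelfSq_intCast, ← Int.cast_natCast, ← Int.cast_mul, ZMod.intCast_zmod_eq_zero_iff_dvd,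
    Nat.cast_pow, sq] at hk
  rw [ZMod.intCast_zmod_eq_zero_iff_dvd]
  exact Int.dvd_of_mul_dvd_mul_left (by exact_mod_cast hp) hk

theorem natCast_self_add_one_pow (p n : ℕ) : ((p : ZMod (p ^ 2)) + 1) ^ n = 1 + n * p := by
  induction n with
  | zero => simp
  | succ n ih =>
    rw [pow_succ _ n, ih]
    push_cast
    linear_combination (n : ZMod (p ^ 2)) * natCast_self_mul_self p

theorem natCast_self_add_one_pow_val_mul (p : ℕ) [NeZero p] (k : ZMod p) (x : ZMod (p ^ 2)) :
    ((p : ZMod (p ^ 2)) + 1) ^ k.val * x = x + mulSelfSq p (k * reduceSq p x) := by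
  have hk : k = reduceSq p (k.val : ZMod (p ^ 2)) := by simp
  rw [natCast_self_add_one_pow]
  conv_rhs => rw [hk, ← map_mul, mulSelfSq_reduceSq]
  ring

end ZMod

namespace SemidirectZModSq

open Multiplicative ZMod

variable {p : ℕ} {φ : Multiplicative (ZMod p) →* MulAut (Multiplicative (ZMod (p ^ 2)))}

/-- The map `(x, k) ↦ (x mod p, k)`, for an action that is trivial modulo `p`. -/
def toProd
    (hφ : ∀ (k : ZMod p) (x : ZMod (p ^ 2)),
      φ (ofAdd k) (ofAdd x) = ofAdd (x + mulSelfSq p (k * reduceSq p x))) :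
    Multiplicative (ZMod (p ^ 2)) ⋊[φ] Multiplicative (ZMod p) →*
      Multiplicative (ZMod p × ZMod p) :=
  MonoidHom.mk' (fun g => ofAdd (reduceSq p g.left.toAdd, g.right.toAdd)) fun g h => by
    have := hφ g.right.toAdd h.left.toAdd
    rw [ofAdd_toAdd, ofAdd_toAdd] at this
    apply toAdd.injective
    simp [this, reduceSq_mulSelfSq]

variable
    (hφ : ∀ (k : ZMod p) (x : ZMod (p ^ 2)),
      φ (ofAdd k) (ofAdd x) = ofAdd (x + mulSelfSq p (k * reduceSq p x)))

theorem toProd_surjective : Function.Surjective (toProd hφ) := fun y => by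
  obtain ⟨x, hx⟩ := reduceSq_surjective p y.toAdd.1
  exact ⟨⟨ofAdd x, ofAdd y.toAdd.2⟩, toAdd.injective (Prod.ext hx rfl)⟩

theorem mem_ker_toProd {g : Multiplicative (ZMod (p ^ 2)) ⋊[φ] Multiplicative (ZMod p)} :
    g ∈ (toProd hφ).ker ↔ ∃ k, SemidirectProduct.inl (ofAdd (mulSelfSq p k)) = g := by
  constructor
  · intro hg
    have h : (reduceSq p g.left.toAdd, g.right.toAdd) = ((0, 0) : ZMod p × ZMod p) :=
      congrArg toAdd ((toProd hφ).mem_ker.1 hg)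
    obtain ⟨k, hk⟩ := exists_mulSelfSq_eq p (congrArg Prod.fst h)
    refine ⟨k, SemidirectProduct.ext (toAdd.injective hk) (toAdd.injective ?_)⟩
    exact (congrArg Prod.snd h).symm
  · rintro ⟨k, rfl⟩
    exact (toProd hφ).mem_ker.2 (toAdd.injective (Prod.ext (reduceSq_mulSelfSq p k) rfl))

include hφ in
theorem inl_mulSelfSq_mem_center (k : ZMod p) :
    (SemidirectProduct.inl (ofAdd (mulSelfSq p k)) :
      Multiplicative (ZMod (p ^ 2)) ⋊[φ] Multiplicative (ZMod p)) ∈ Subgroup.center _ := by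
  refine Subgroup.mem_center_iff.2 fun g => ?_
  have h := hφ g.right.toAdd (mulSelfSq p k)
  rw [ofAdd_toAdd, reduceSq_mulSelfSq, mul_zero, map_zero, add_zero] at h
  ext1
  · simp [h, mul_comm]
  · simp

theorem commutator_eq_ker_toProd :
    commutator (Multiplicative (ZMod (p ^ 2)) ⋊[φ] Multiplicative (ZMod p)) =
      (toProd hφ).ker := by
  refine le_antisymm (Abelianization.commutator_subset_ker _) fun g hg => ?_
  obtain ⟨k, rfl⟩ := (mem_ker_toProd hφ).1 hg
  have h := SemidirectProduct.inl_aut (φ := φ) (ofAdd k) (ofAdd 1)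
  rw [hφ, map_one, mul_one, ofAdd_add, map_mul, map_inv, ← eq_inv_mul_iff_mul_eq] at h
  rw [h, ← mul_assoc, ← mul_assoc]
  have hc := Subgroup.commutator_mem_commutator
    (Subgroup.mem_top (SemidirectProduct.inl (φ := φ) (ofAdd (1 : ZMod (p ^ 2))))⁻¹)
    (Subgroup.mem_top (SemidirectProduct.inr (φ := φ) (ofAdd k)))
  rwa [commutatorElement_def, inv_inv] at hc

include hφ in
theorem nonempty_abelianization_mulEquiv :
    Nonempty (Abelianization (Multiplicative (ZMod (p ^ 2)) ⋊[φ] Multiplicative (ZMod p)) ≃*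
      Multiplicative (ZMod p × ZMod p)) :=
  ⟨(QuotientGroup.quotientMulEquivOfEq (commutator_eq_ker_toProd hφ)).trans
    (QuotientGroup.quotientKerEquivOfSurjective _ (toProd_surjective hφ))⟩

include hφ in
theorem nonempty_commutator_mulEquiv (hp : p ≠ 0) :
    Nonempty (commutator (Multiplicative (ZMod (p ^ 2)) ⋊[φ] Multiplicative (ZMod p)) ≃*
      Multiplicative (ZMod p)) := by
  let j : Multiplicative (ZMod p) →*
      Multiplicative (ZMod (p ^ 2)) ⋊[φ] Multiplicative (ZMod p) :=
    SemidirectProduct.inl.comp (mulSelfSq p).toMultiplicative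
  have hj : Function.Injective j :=
    SemidirectProduct.inl_injective.comp (mulSelfSq_injective hp)
  have hr : j.range = commutator _ := by
    rw [commutator_eq_ker_toProd hφ]
    ext g
    exact (mem_ker_toProd hφ).symm
  exact ⟨((MonoidHom.ofInjective hj).trans (MulEquiv.subgroupCongr hr)).symm⟩

include hφ in
theorem not_qSplit (hp : p.Prime) (hodd : Odd p) :
    ¬ QSplit (Multiplicative (ZMod (p ^ 2)) ⋊[φ] Multiplicative (ZMod p)) := by
  rintro ⟨s, hs, hsec⟩
  have := Fact.mk hp
  obtain ⟨e⟩ := nonempty_abelianization_mulEquiv hφ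
  set u : Multiplicative (ZMod (p ^ 2)) ⋊[φ] Multiplicative (ZMod p) :=
    SemidirectProduct.inl (ofAdd 1) with hu
  have ha : Abelianization.of u ^ p = 1 := by
    apply e.injective
    rw [map_pow, map_one]
    apply toAdd.injective
    ext <;> simp
  have hpow := hs.1.pow_eq_one_of_odd hodd ha
  have hker : u⁻¹ * s (Abelianization.of u) ∈ (toProd hφ).ker := by
    rw [← commutator_eq_ker_toProd hφ, ← Abelianization.ker_of, MonoidHom.mem_ker, map_mul,
      map_inv, hsec, inv_mul_cancel]
  obtain ⟨k, hk⟩ := (mem_ker_toProd hφ).1 hker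
  rw [eq_inv_mul_iff_mul_eq, hu, ← map_mul] at hk
  rw [← hk, ← map_pow, ← map_one SemidirectProduct.inl] at hpow
  have h := congrArg toAdd (SemidirectProduct.inl_injective hpow)
  rw [toAdd_pow, toAdd_one, ← ofAdd_add, toAdd_ofAdd, nsmul_eq_mul, ← mulSelfSq_reduceSq, map_add,
    reduceSq_mulSelfSq, map_one, add_zero] at h
  exact one_ne_zero (mulSelfSq_injective hp.ne_zero (h.trans (map_zero _).symm))

end SemidirectZModSq

/-- For an odd prime `p`, the semidirect product `(ℤ/p²ℤ) ⋊ (ℤ/pℤ)`, where the generator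
of `ℤ/pℤ` acts by multiplication by `p+1`, is a nil₂-group which is not q-split; its
abelianization is `(ℤ/pℤ)²` and its commutator subgroup is `ℤ/pℤ`. -/
theorem stmt_18 (p : ℕ) (hp : p.Prime) (hodd : Odd p)
    (φ : Multiplicative (ZMod p) →* MulAut (Multiplicative (ZMod (p ^ 2))))
    (hφ : ∀ (k : ZMod p) (x : ZMod (p ^ 2)),
      φ (Multiplicative.ofAdd k) (Multiplicative.ofAdd x)
        = Multiplicative.ofAdd (((p : ZMod (p ^ 2)) + 1) ^ k.val * x)) :
    commutator (Multiplicative (ZMod (p ^ 2)) ⋊[φ] Multiplicative (ZMod p)) ≤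
      Subgroup.center (Multiplicative (ZMod (p ^ 2)) ⋊[φ] Multiplicative (ZMod p)) ∧
    ¬ QSplit (Multiplicative (ZMod (p ^ 2)) ⋊[φ] Multiplicative (ZMod p)) ∧
    Nonempty (Abelianization (Multiplicative (ZMod (p ^ 2)) ⋊[φ] Multiplicative (ZMod p)) ≃*
      Multiplicative (ZMod p × ZMod p)) ∧
    Nonempty (↥(commutator (Multiplicative (ZMod (p ^ 2)) ⋊[φ] Multiplicative (ZMod p))) ≃*
      Multiplicative (ZMod p)) := by
  have := NeZero.mk hp.ne_zero
  simp only [ZMod.natCast_self_add_one_pow_val_mul] at hφ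
  refine ⟨fun g hg => ?_, SemidirectZModSq.not_qSplit hφ hp hodd,
    SemidirectZModSq.nonempty_abelianization_mulEquiv hφ,
    SemidirectZModSq.nonempty_commutator_mulEquiv hφ hp.ne_zero⟩
  rw [SemidirectZModSq.commutator_eq_ker_toProd hφ] at hg
  obtain ⟨k, rfl⟩ := (SemidirectZModSq.mem_ker_toProd hφ).1 hg
  exact SemidirectZModSq.inl_mulSelfSq_mem_center hφ k
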